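/- Let d be a squarefree positive integer with discriminant Δ_d > (29524500000005)², and let F = ℚ(√d). Then every positive definite classic universal quadratic 𝒪_F-lattice has rank at least 8; more precisely, such a lattice contains 8 linearly independent vectors. -/

import Mathlib

noncomputable section

/-- `Δ_d`: the discriminant of `ℚ(√d)` for squarefree `d > 1`. -/
def Delta (d : ℕ) : ℕ := if d % 4 = 1 then d else 4 * d

/-- `ω_d`, viewed as a real number (with `√d > 0`). -/
def omegaR (d : ℕ) : ℝ := if d % 4 = 1 then (1 + Real.sqrt d) / 2 else Real.sqrt d

/-- The conjugate `ω̄_d`, viewed as a real number. -/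
def omegaConjR (d : ℕ) : ℝ := if d % 4 = 1 then (1 - Real.sqrt d) / 2 else -Real.sqrt d

/-- `F = ℚ(√d)`, realized as an intermediate field of `ℝ/ℚ` via the embedding with `√d > 0`. -/
def Fd (d : ℕ) : IntermediateField ℚ ℝ := IntermediateField.adjoin ℚ {Real.sqrt d}

/-- The ring of integers `𝒪_F` of `F = ℚ(√d)`. -/
abbrev Od (d : ℕ) := NumberField.RingOfIntegers (Fd d)

/-- An element of `F` is totally positive if its image under each of the
(two) real embeddings of `F` is positive. -/
def TotPos {d : ℕ} (x : Fd d) : Prop := ∀ σ : Fd d →ₐ[ℚ] ℝ, 0 < σ x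

/-- The conjugate `x̄` of `x ∈ F = ℚ(√d)`, as a real number: `x̄ = tr(x) - x`. -/
def conjR {d : ℕ} (x : Fd d) : ℝ := ((Algebra.trace ℚ (Fd d) x : ℚ) : ℝ) - (x : ℝ)

/-- A (not necessarily classic) quadratic `𝒪_F`-lattice: a finitely generated
`𝒪_F`-module `L` with a quadratic map `Q : L → 𝒪_F` whose associated form
`B(x,y) = (Q(x+y)-Q(x)-Q(y))/2` (with values a priori in `F`) is symmetric
bilinear and satisfies `B(x,x) = Q(x)`. -/
structure QuadLattice (d : ℕ) where
  carrier : Type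
  [isAddCommGroup : AddCommGroup carrier]
  [isModule : Module (Od d) carrier]
  finite : Module.Finite (Od d) carrier
  Q : carrier → Od d
  B : carrier → carrier → Fd d
  B_symm : ∀ x y, B x y = B y x
  B_add_left : ∀ x y z, B (x + y) z = B x z + B y z
  B_smul_left : ∀ (a : Od d) (x y : carrier), B (a • x) y = (a : Fd d) * B x y
  B_self : ∀ x, B x x = (Q x : Fd d)
  B_def : ∀ x y, 2 * B x y = (Q (x + y) : Fd d) - (Q x : Fd d) - (Q y : Fd d)

attribute [instance] QuadLattice.isAddCommGroup QuadLattice.isModule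

namespace QuadLattice

variable {d : ℕ} (L : QuadLattice d)

/-- `L` is classic if the bilinear form takes values in `𝒪_F`. -/
def IsClassic : Prop := ∀ x y, L.B x y ∈ integralClosure ℤ (Fd d)

/-- `L` is positive definite if `Q(x)` is totally positive for all `x ≠ 0`. -/
def PosDef : Prop := ∀ x : L.carrier, x ≠ 0 → TotPos (L.Q x : Fd d)

/-- `L` is universal if `Q(L) = 𝒪_F⁺ ∪ {0}`. -/
def Universal : Prop :=
  (Set.range fun v => L.Q v) = {a : Od d | TotPos (a : Fd d)} ∪ {0}

end QuadLattice

section Escalation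

/-- The determinant of the Gram matrix of vectors of norms `1`, `2`, `n`. -/
def gramThree (n a p q : ℤ) : ℤ := n * (2 - a * a) - (2 * (p * p) - 2 * a * p * q + q * q)

/-- The determinant of the Gram matrix of vectors of norms `1`, `2`, `n`, `m`. -/
def gramFour (n m a p q x y z : ℤ) : ℤ :=
  m * gramThree n a p q -
    ((2 * n - q * q) * (x * x) + (n - p * p) * (y * y) + (2 - a * a) * (z * z) +
      2 * ((p * q - a * n) * (x * y)) + 2 * ((a * q - 2 * p) * (x * z)) +
      2 * ((a * p - q) * (y * z)))

/-- The norm of a third escalation vector, given the inner product `a` of vectors of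
norms `1` and `2`. -/
def thirdNorm (a : ℤ) : ℕ := if a = 0 then 5 else 3

/-- The norm of a fourth escalation vector, given the determinant of the ternary lattice. -/
def fourthNorm (D : ℤ) : ℕ :=
  if D = 3 then 6 else if D = 2 ∨ D = 8 then 14 else if D = 6 ∨ D = 10 then 10 else 7

lemma gramFour_ne_zero : ∀ a ∈ Finset.Icc (-1 : ℤ) 1, ∀ p ∈ Finset.Icc (-2 : ℤ) 2,
    ∀ q ∈ Finset.Icc (-3 : ℤ) 3, 0 ≤ gramThree (thirdNorm a) a p q →
    ∀ x ∈ Finset.Icc (-3 : ℤ) 3, ∀ y ∈ Finset.Icc (-5 : ℤ) 5, ∀ z ∈ Finset.Icc (-8 : ℤ) 8,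
      gramFour (thirdNorm a) (fourthNorm (gramThree (thirdNorm a) a p q)) a p q x y z ≠ 0 := by
  decide +kernel

lemma thirdNorm_le (a : ℤ) : thirdNorm a ≤ 5 := by
  unfold thirdNorm; split_ifs <;> norm_num

lemma fourthNorm_le (D : ℤ) : fourthNorm D ≤ 14 := by
  unfold fourthNorm; split_ifs <;> norm_num

/-- An integral form which is nonnegative on small combinations of vectors of norms
`1, …, 15` has four of these vectors with nonsingular Gram matrix. -/
lemma exists_gram_det_ne_zero (g : ℕ → ℕ → ℤ) (hs : ∀ i j, g i j = g j i)
    (hd : ∀ i ≤ 15, g i i = i) (hb : ∀ i ≤ 15, ∀ j ≤ 15, |g i j| ≤ 15)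
    (hp : ∀ i ≤ 15, ∀ j ≤ 15, ∀ k ≤ 15, ∀ x y z : ℤ, |x| ≤ 15 → |y| ≤ 15 → |z| ≤ 15 →
      0 ≤ x * x * g i i + y * y * g j j + z * z * g k k +
        2 * (x * y * g i j) + 2 * (x * z * g i k) + 2 * (y * z * g j k)) :
    ∃ s : Fin 4 → ℕ, (∀ a, s a ≤ 15) ∧ (Matrix.of fun a b => g (s a) (s b)).det ≠ 0 := by
  have hcs : ∀ i : ℕ, 0 < i → i ≤ 15 → ∀ j ≤ 15, g i j * g i j ≤ i * j := by
    intro i hi hi15 j hj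
    have h := hp i hi15 j hj 0 (by norm_num) (-g i j) i 0 (by simpa using hb i hi15 j hj)
      (by rw [abs_le]; omega) (by norm_num)
    rw [hd i hi15, hd j hj] at h
    have hi' : (0 : ℤ) < i := by exact_mod_cast hi
    nlinarith
  have habs : ∀ c t N : ℤ, c * c ≤ N → N < (t + 1) * (t + 1) → 0 ≤ t →
      c ∈ Finset.Icc (-t) t := by
    intro c t N h1 h2 h3
    rw [Finset.mem_Icc]
    constructor <;> nlinarith
  set a := g 1 2 with ha
  set n := thirdNorm a with hn
  have hn5 : n ≤ 5 := thirdNorm_le a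
  set p := g 1 n with hpdef
  set q := g 2 n with hqdef
  have h12 : a * a ≤ 2 := by simpa using hcs 1 (by norm_num) (by norm_num) 2 (by norm_num)
  have h1n : p * p ≤ n := by simpa using hcs 1 (by norm_num) (by norm_num) n (by omega)
  have h2n : q * q ≤ 2 * n := by simpa using hcs 2 (by norm_num) (by norm_num) n (by omega)
  have hnZ : (n : ℤ) ≤ 5 := by exact_mod_cast hn5
  have ma := habs a 1 2 h12 (by norm_num) (by norm_num)
  have mp := habs p 2 5 (by linarith) (by norm_num) (by norm_num)
  have mq := habs q 3 10 (by linarith) (by norm_num) (by norm_num)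
  have ma' := Finset.mem_Icc.1 ma
  have mp' := Finset.mem_Icc.1 mp
  have mq' := Finset.mem_Icc.1 mq
  have hpos : 0 ≤ gramThree n a p q := by
    have h := hp 1 (by norm_num) 2 (by norm_num) n (by omega) (a * q - 2 * p) (a * p - q)
      (2 - a * a)
      (by rw [abs_le]; constructor <;> nlinarith)
      (by rw [abs_le]; constructor <;> nlinarith)
      (by rw [abs_le]; constructor <;> nlinarith)
    rw [hd 1 (by norm_num), hd 2 (by norm_num), hd n (by omega), ← ha, ← hpdef, ← hqdef] at h
    have hfac : 0 ≤ (2 - a * a) * gramThree n a p q := by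
      unfold gramThree
      push_cast at h
      linarith
    have h2 : 0 < 2 - a * a := by nlinarith
    exact nonneg_of_mul_nonneg_right hfac h2
  set m := fourthNorm (gramThree n a p q) with hm
  have hm14 : m ≤ 14 := fourthNorm_le _
  have hmZ : (m : ℤ) ≤ 14 := by exact_mod_cast hm14
  have h1m := hcs 1 (by norm_num) (by norm_num) m (by omega)
  have h2m := hcs 2 (by norm_num) (by norm_num) m (by omega)
  have hn3 : 0 < n := by rw [hn]; unfold thirdNorm; split_ifs <;> norm_num
  have hnm := hcs n hn3 (by omega) m (by omega)
  have key := gramFour_ne_zero a ma p mp q mq hpos (g 1 m)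
    (habs _ 3 14 (by push_cast at h1m; linarith) (by norm_num) (by norm_num)) (g 2 m)
    (habs _ 5 28 (by push_cast at h2m; linarith) (by norm_num) (by norm_num)) (g n m)
    (habs _ 8 70 (by nlinarith) (by norm_num) (by norm_num))
  rw [← hn, ← hm] at key
  refine ⟨![1, 2, n, m], ?_, ?_⟩
  · intro i
    fin_cases i <;> simp <;> omega
  · intro h0
    apply key
    rw [← h0]
    simp [Matrix.det_succ_row_zero, Fin.sum_univ_succ, Fin.succAbove]
    rw [hd 1 (by norm_num), hd 2 (by norm_num), hd n (by omega), hd m (by omega), hs m 1, hs m 2,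
      hs m n, hs n 1, hs n 2, hs 2 1, ← ha, ← hpdef, ← hqdef]
    unfold gramFour gramThree
    push_cast
    ring

end Escalation

section Matrices

lemma abs_sum_mul_le {n : ℕ} (M : Matrix (Fin n) (Fin n) ℝ) (x : Fin n → ℝ) {K r : ℝ}
    (hM : ∀ i j, |M i j| ≤ K) (hx : ∀ i, |x i| ≤ r) (i : Fin n) :
    |(M.mulVec x) i| ≤ n * (K * r) := by
  calc |(M.mulVec x) i| = |∑ j, M i j * x j| := rfl
    _ ≤ ∑ j, |M i j * x j| := Finset.abs_sum_le_sum_abs _ _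
    _ ≤ ∑ _j : Fin n, K * r := by
        refine Finset.sum_le_sum fun j _ => ?_
        rw [abs_mul]
        exact mul_le_mul (hM i j) (hx j) (abs_nonneg _) ((abs_nonneg _).trans (hM i j))
    _ = n * (K * r) := by simp

lemma abs_adjugate_le {n : ℕ} (M : Matrix (Fin (n + 1)) (Fin (n + 1)) ℝ) {K : ℝ}
    (hM : ∀ i j, |M i j| ≤ K) (i j : Fin (n + 1)) :
    |M.adjugate i j| ≤ n.factorial * K ^ n := by
  rw [Matrix.adjugate_fin_succ_eq_det_submatrix, abs_mul, abs_pow, abs_neg, abs_one, one_pow,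
    one_mul]
  have h := Matrix.det_le (A := M.submatrix j.succAbove i.succAbove)
    (abv := AbsoluteValue.abs) (x := K) (fun a b => hM _ _)
  simpa using h

/-- Solutions of an integral linear system are bounded in terms of the right hand side. -/
lemma abs_le_of_mulVec_eq (M : Matrix (Fin 4) (Fin 4) ℤ) (hM : ∀ i j, |M i j| ≤ 15)
    (hdet : M.det ≠ 0) (x y : Fin 4 → ℝ) (h : (M.map (Int.cast : ℤ → ℝ)).mulVec x = y) {r : ℝ}
    (hy : ∀ i, |y i| ≤ r) (i : Fin 4) : |x i| ≤ 81000 * r := by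
  set N := M.map (Int.cast : ℤ → ℝ) with hN
  have hNdet : N.det = (M.det : ℝ) := by
    rw [hN]; exact (RingHom.map_det (Int.castRingHom ℝ) M).symm
  have hNb : ∀ i j, |N i j| ≤ 15 := fun i j => by
    have := hM i j
    simp only [hN, Matrix.map_apply]
    exact_mod_cast this
  have hadj : N.adjugate.mulVec y = N.det • x := by
    rw [← h, Matrix.mulVec_mulVec, Matrix.adjugate_mul, Matrix.smul_mulVec, Matrix.one_mulVec]
  have hbound := abs_sum_mul_le N.adjugate y (abs_adjugate_le N hNb) hy i
  rw [hadj, Pi.smul_apply, smul_eq_mul, abs_mul] at hbound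
  have h1 : (1 : ℝ) ≤ |N.det| := by
    rw [hNdet]
    exact_mod_cast Int.one_le_abs hdet
  have hf : ((3 : ℕ).factorial : ℝ) = 6 := by norm_num [Nat.factorial]
  rw [hf] at hbound
  norm_num at hbound
  nlinarith [abs_nonneg (x i)]

/-- A symmetric block matrix with bounded integral blocks, whose lower right block is dominated
by a large multiple of a nonsingular matrix, is nonsingular. -/
lemma block_system_trivial (A C D₀ D₁ : Matrix (Fin 4) (Fin 4) ℤ) (hA : ∀ i j, |A i j| ≤ 15)
    (hC : ∀ i j, |C i j| ≤ 15) (hD₀ : ∀ i j, |D₀ i j| ≤ 30) (hD₁ : ∀ i j, |D₁ i j| ≤ 15)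
    (hAdet : A.det ≠ 0) (hDdet : D₁.det ≠ 0) {t : ℝ} (ht : 29524500000005 < t)
    (a b : Fin 4 → ℝ)
    (h₁ : ∀ i, ∑ j, (A i j : ℝ) * a j + ∑ j, (C i j : ℝ) * b j = 0)
    (h₂ : ∀ i, ∑ j, (C j i : ℝ) * a j + ∑ j, ((D₀ i j : ℝ) + D₁ i j * t) * b j = 0) :
    a = 0 ∧ b = 0 := by
  obtain ⟨k, -, hk⟩ := Finset.exists_max_image Finset.univ (fun i => |b i|)
    ⟨0, Finset.mem_univ _⟩
  set β := |b k| with hβ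
  have hb : ∀ i, |b i| ≤ β := fun i => hk i (Finset.mem_univ i)
  have hβ0 : 0 ≤ β := abs_nonneg _
  have hcast : ∀ (M : Matrix (Fin 4) (Fin 4) ℤ) (K : ℤ), (∀ i j, |M i j| ≤ K) →
      ∀ i j, |M.map (Int.cast : ℤ → ℝ) i j| ≤ (K : ℝ) := fun M K h i j => by
    have := h i j
    simp only [Matrix.map_apply]
    exact_mod_cast this
  have ha : ∀ i, |a i| ≤ 81000 * (60 * β) := by
    refine abs_le_of_mulVec_eq A hA hAdet a (-(C.map (Int.cast : ℤ → ℝ)).mulVec b) ?_ ?_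
    · funext i
      have := h₁ i
      simp only [Matrix.mulVec, dotProduct, Matrix.map_apply, Pi.neg_apply]
      linarith
    · intro i
      have := abs_sum_mul_le _ b (hcast C 15 hC) hb i
      rw [Pi.neg_apply, abs_neg]
      norm_num at this
      linarith
  have hCt : ∀ i j, |C.transpose i j| ≤ 15 := fun i j => hC j i
  have hb' : ∀ i, |(t • b) i| ≤ 81000 * (60 * (81000 * (60 * β)) + 120 * β) := by
    refine abs_le_of_mulVec_eq D₁ hD₁ hDdet (t • b)
      (-((C.transpose.map (Int.cast : ℤ → ℝ)).mulVec a + (D₀.map (Int.cast : ℤ → ℝ)).mulVec b))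
      ?_ ?_
    · funext i
      have := h₂ i
      simp only [Matrix.mulVec, dotProduct, Matrix.map_apply, Pi.neg_apply, Pi.add_apply,
        Matrix.transpose_apply, Pi.smul_apply, smul_eq_mul]
      simp only [add_mul, Finset.sum_add_distrib] at this
      have e : ∀ j, (D₁ i j : ℝ) * (t * b j) = D₁ i j * t * b j := fun j => by ring
      simp only [e]
      linarith
    · intro i
      have e₁ := abs_sum_mul_le _ a (hcast _ 15 hCt) ha i
      have e₂ := abs_sum_mul_le _ b (hcast D₀ 30 hD₀) hb i
      rw [Pi.neg_apply, abs_neg]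
      refine (abs_add_le _ _).trans ?_
      norm_num at e₁ e₂
      linarith
  have hβ' : β = 0 := by
    have := hb' k
    rw [Pi.smul_apply, smul_eq_mul, abs_mul, abs_of_pos (by linarith : 0 < t), ← hβ] at this
    nlinarith
  constructor
  · funext i
    have := ha i
    rw [hβ'] at this
    simpa using this
  · funext i
    have := hb i
    rw [hβ'] at this
    simpa using this

end Matrices

section QuadraticField

lemma exists_int_eq_of_squarefree_mul_sq {d : ℕ} (hd : Squarefree d) {q : ℚ} {M : ℤ}
    (h : (d : ℚ) * q ^ 2 = M) : ∃ k : ℤ, q = k := by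
  have e : (d : ℤ) * q.num ^ 2 = M * (q.den : ℤ) ^ 2 := by
    have : (d : ℚ) * q.num ^ 2 = M * (q.den : ℚ) ^ 2 := by
      rw [← h, ← Rat.mul_den_eq_num q]
      ring
    exact_mod_cast this
  have hcop : IsCoprime ((q.den : ℤ) ^ 2) (q.num ^ 2) := by
    refine IsCoprime.pow ?_
    rw [Int.isCoprime_iff_gcd_eq_one, Int.gcd_comm]
    exact q.reduced
  have hdvd : (q.den : ℤ) ^ 2 ∣ d :=
    hcop.dvd_of_dvd_mul_right (Dvd.intro_left _ e.symm)
  have hdvd' : q.den * q.den ∣ d := by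
    rw [← sq]; exact_mod_cast hdvd
  have h1 : q.den = 1 := Nat.isUnit_iff.1 (hd _ hdvd')
  exact ⟨q.num, ((Rat.den_eq_one_iff q).1 h1).symm⟩

lemma isIntegral_of_sq_eq {R : Type*} [CommRing R] {x : R} (b c : ℤ)
    (h : x ^ 2 = b * x + c) : IsIntegral ℤ x := by
  refine ⟨Polynomial.X ^ 2 - (Polynomial.C b * Polynomial.X + Polynomial.C c), ?_, ?_⟩
  · monicity!
  · rw [Polynomial.eval₂_sub, Polynomial.eval₂_add, Polynomial.eval₂_mul, Polynomial.eval₂_C,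
      Polynomial.eval₂_C, Polynomial.eval₂_X, Polynomial.eval₂_X_pow, h]
    simp

lemma exists_int_of_isIntegral_real {q : ℚ} (h : IsIntegral ℤ (q : ℝ)) : ∃ k : ℤ, q = k := by
  have h' : IsIntegral ℤ q :=
    (isIntegral_algebraMap_iff (B := ℝ) (algebraMap ℚ ℝ).injective).1 (by simpa using h)
  obtain ⟨k, hk⟩ := IsIntegrallyClosed.isIntegral_iff.1 h'
  exact ⟨k, by simpa using hk.symm⟩

/-- The element `√d` of `ℚ(√d)`. -/
def sqrtGen (d : ℕ) : Fd d := ⟨√(d : ℝ), IntermediateField.mem_adjoin_simple_self ℚ _⟩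

lemma coe_sqrtGen (d : ℕ) : ((sqrtGen d : Fd d) : ℝ) = √(d : ℝ) := rfl

lemma sqrtGen_sq (d : ℕ) : sqrtGen d ^ 2 = (d : Fd d) := by
  apply Subtype.ext
  push_cast
  rw [coe_sqrtGen, Real.sq_sqrt (Nat.cast_nonneg d)]

lemma isIntegral_sqrt (d : ℕ) : IsIntegral ℚ √(d : ℝ) := by
  have h : IsIntegral ℤ √(d : ℝ) :=
    isIntegral_of_sq_eq 0 d (by rw [Real.sq_sqrt (Nat.cast_nonneg d)]; simp)
  exact h.tower_top

lemma exists_rat_eq (d : ℕ) (β : Fd d) : ∃ r t : ℚ, β = r + t * sqrtGen d := by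
  have hβ : (β : ℝ) ∈ Algebra.adjoin ℚ {√(d : ℝ)} := by
    rw [← IntermediateField.adjoin_simple_toSubalgebra_of_isAlgebraic
      (isIntegral_sqrt d).isAlgebraic]
    exact β.2
  have key : ∃ r t : ℚ, (β : ℝ) = r + t * √(d : ℝ) := by
    generalize (β : ℝ) = b at hβ ⊢
    induction hβ using Algebra.adjoin_induction with
    | mem x hx => exact ⟨0, 1, by simpa using hx⟩
    | algebraMap r => exact ⟨r, 0, by simp⟩
    | add x y _ _ hx hy =>
      obtain ⟨r, t, rfl⟩ := hx
      obtain ⟨r', t', rfl⟩ := hy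
      exact ⟨r + r', t + t', by push_cast; ring⟩
    | mul x y _ _ hx hy =>
      obtain ⟨r, t, rfl⟩ := hx
      obtain ⟨r', t', rfl⟩ := hy
      refine ⟨r * r' + t * t' * d, r * t' + t * r', ?_⟩
      have := Real.sq_sqrt (Nat.cast_nonneg (α := ℝ) d)
      push_cast
      linear_combination (t * t' : ℝ) * this
  obtain ⟨r, t, h⟩ := key
  refine ⟨r, t, Subtype.ext ?_⟩
  rw [h]
  push_cast
  rw [coe_sqrtGen]

lemma exists_conj {d : ℕ} (hd : ¬ IsSquare d) :
    ∃ σ : Fd d →ₐ[ℚ] ℝ, σ (sqrtGen d) = -√(d : ℝ) := by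
  have hirr : Irreducible (Polynomial.X ^ 2 - Polynomial.C (d : ℚ)) := by
    refine X_pow_sub_C_irreducible_of_prime Nat.prime_two fun b hb => ?_
    exact hd (Rat.isSquare_natCast_iff.1 ⟨b, by rw [← hb, sq]⟩)
  have hmin : Polynomial.X ^ 2 - Polynomial.C (d : ℚ) = minpoly ℚ √(d : ℝ) :=
    minpoly.eq_of_irreducible_of_monic hirr (by simp) (by monicity!)
  have hroot : -√(d : ℝ) ∈ (minpoly ℚ √(d : ℝ)).aroots ℝ := by
    rw [Polynomial.mem_aroots]
    refine ⟨minpoly.ne_zero (isIntegral_sqrt d), ?_⟩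
    rw [← hmin]
    simp
  exact ⟨(IntermediateField.algHomAdjoinIntegralEquiv ℚ (isIntegral_sqrt d)).symm ⟨_, hroot⟩,
    IntermediateField.algHomAdjoinIntegralEquiv_symm_apply_gen ℚ (isIntegral_sqrt d) ⟨_, hroot⟩⟩

lemma algHom_eq_or_eq {d : ℕ} {σ : Fd d →ₐ[ℚ] ℝ} (hσ : σ (sqrtGen d) = -√(d : ℝ))
    (τ : Fd d →ₐ[ℚ] ℝ) : τ = (Fd d).val ∨ τ = σ := by
  have hsq : τ (sqrtGen d) ^ 2 = √(d : ℝ) ^ 2 := by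
    rw [← map_pow, sqrtGen_sq, map_natCast, Real.sq_sqrt (Nat.cast_nonneg d)]
  refine (sq_eq_sq_iff_eq_or_eq_neg.1 hsq).imp (fun h => ?_) (fun h => ?_)
  · refine AlgHom.ext fun β => ?_
    obtain ⟨r, t, rfl⟩ := exists_rat_eq d β
    simp only [map_add, map_mul, map_ratCast, h]
    rfl
  · refine AlgHom.ext fun β => ?_
    obtain ⟨r, t, rfl⟩ := exists_rat_eq d β
    simp only [map_add, map_mul, map_ratCast, h, hσ]

/-- Integral elements of `ℚ(√d)` have the form `(T + k√d) / 2` with `T² - d k² ∈ 4ℤ`. -/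
lemma exists_half_int_of_isIntegral {d : ℕ} (hd : Squarefree d) {σ : Fd d →ₐ[ℚ] ℝ}
    (hσ : σ (sqrtGen d) = -√(d : ℝ)) (β : Fd d) (hβ : IsIntegral ℤ β) :
    ∃ T k N : ℤ, T ^ 2 - d * k ^ 2 = 4 * N ∧ 2 * β = T + k * sqrtGen d := by
  obtain ⟨r, t, rfl⟩ := exists_rat_eq d β
  have h₁ := hβ.map (Fd d).val
  have h₂ := hβ.map σ
  have e₁ : (Fd d).val ((r : Fd d) + t * sqrtGen d) = r + t * √(d : ℝ) := by
    simp only [map_add, map_mul, map_ratCast]; rfl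
  have e₂ : σ ((r : Fd d) + t * sqrtGen d) = r - t * √(d : ℝ) := by
    simp only [map_add, map_mul, map_ratCast, hσ]; ring
  rw [e₁] at h₁
  rw [e₂] at h₂
  have hs := Real.sq_sqrt (Nat.cast_nonneg (α := ℝ) d)
  obtain ⟨T, hT⟩ := exists_int_of_isIntegral_real (q := 2 * r) (by
    have e : ((2 * r : ℚ) : ℝ) = (r + t * √(d : ℝ)) + (r - t * √(d : ℝ)) := by push_cast; ring
    rw [e]; exact h₁.add h₂)
  obtain ⟨N, hN⟩ := exists_int_of_isIntegral_real (q := r ^ 2 - d * t ^ 2) (by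
    have e : ((r ^ 2 - d * t ^ 2 : ℚ) : ℝ) = (r + t * √(d : ℝ)) * (r - t * √(d : ℝ)) := by
      push_cast; linear_combination (t ^ 2 : ℝ) * hs
    rw [e]; exact h₁.mul h₂)
  obtain ⟨k, hk⟩ := exists_int_eq_of_squarefree_mul_sq hd (q := 2 * t) (M := T ^ 2 - 4 * N) (by
    push_cast; rw [← hT, ← hN]; ring)
  refine ⟨T, k, N, ?_, ?_⟩
  · have : (T : ℚ) ^ 2 - d * k ^ 2 = 4 * N := by rw [← hT, ← hN, ← hk]; ring
    exact_mod_cast this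
  · have hT' : (2 : Fd d) * r = T := by exact_mod_cast congrArg (Rat.cast : ℚ → Fd d) hT
    have hk' : (2 : Fd d) * t = k := by exact_mod_cast congrArg (Rat.cast : ℚ → Fd d) hk
    linear_combination hT' + sqrtGen d * hk'

lemma sqrt_Delta (d : ℕ) :
    √(Delta d : ℝ) = if d % 4 = 1 then √(d : ℝ) else 2 * √(d : ℝ) := by
  unfold Delta
  split_ifs
  · rfl
  · push_cast
    rw [Real.sqrt_mul (by norm_num), show (4 : ℝ) = 2 ^ 2 by norm_num,
      Real.sqrt_sq (by norm_num)]

/-- An integral generator `θ` of the ring of integers, with `θ - θ̄ = √Δ`. -/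
lemma exists_integral_generator {d : ℕ} (hd : Squarefree d) {σ : Fd d →ₐ[ℚ] ℝ}
    (hσ : σ (sqrtGen d) = -√(d : ℝ)) :
    ∃ θ : Fd d, IsIntegral ℤ θ ∧ (θ : ℝ) - σ θ = √(Delta d : ℝ) ∧
      ∀ β : Fd d, IsIntegral ℤ β → ∃ x y : ℤ, β = x + y * θ := by
  rw [sqrt_Delta]
  by_cases h4 : d % 4 = 1
  · refine ⟨(1 + sqrtGen d) / 2, ?_, ?_, fun β hβ => ?_⟩
    · obtain ⟨c, hc⟩ : ∃ c : ℤ, (d : ℤ) = 4 * c + 1 := ⟨d / 4, by omega⟩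
      have hc' : (d : Fd d) = 4 * c + 1 := by exact_mod_cast congrArg (Int.cast : ℤ → Fd d) hc
      refine isIntegral_of_sq_eq 1 c ?_
      have := sqrtGen_sq d
      push_cast
      linear_combination (1 / 4 : Fd d) * this + (1 / 4 : Fd d) * hc'
    · rw [if_pos h4]
      simp only [map_div₀, map_add, map_one, map_ofNat, hσ]
      change (1 + √(d : ℝ)) / 2 - _ = _
      ring
    · obtain ⟨T, k, N, hN, h⟩ := exists_half_int_of_isIntegral hd hσ β hβ
      obtain ⟨x, hx⟩ : ∃ x : ℤ, T = 2 * x + k := by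
        have hpar : (T - k) % 2 = 0 := by
          obtain ⟨c, hc⟩ : ∃ c : ℤ, (d : ℤ) = 4 * c + 1 := ⟨d / 4, by omega⟩
          rw [hc] at hN
          have h2 : Even (T ^ 2 - k ^ 2) := ⟨2 * N + 2 * c * k ^ 2, by linarith⟩
          have h3 : Even (T - k) := by
            rw [Int.even_sub] at h2 ⊢
            simpa [Int.even_pow] using h2
          exact Int.even_iff.1 h3
        exact ⟨(T - k) / 2, by omega⟩
      refine ⟨x, k, ?_⟩
      rw [hx] at h
      push_cast at h
      linear_combination (1 / 2 : Fd d) * h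
  · refine ⟨sqrtGen d, ?_, ?_, fun β hβ => ?_⟩
    · exact isIntegral_of_sq_eq 0 d (by rw [sqrtGen_sq]; simp)
    · rw [if_neg h4, hσ, coe_sqrtGen]
      ring
    · obtain ⟨T, k, N, hN, h⟩ := exists_half_int_of_isIntegral hd hσ β hβ
      have h0 : d % 4 ≠ 0 := fun h0 => by
        have := hd 2 (by simpa using Nat.dvd_of_mod_eq_zero h0)
        simp at this
      obtain ⟨x, y, rfl, rfl⟩ : ∃ x y : ℤ, T = 2 * x ∧ k = 2 * y := by
        obtain ⟨x, hx⟩ := Int.even_or_odd' T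
        obtain ⟨y, hy⟩ := Int.even_or_odd' k
        obtain ⟨c, hc⟩ : ∃ c : ℤ, (d : ℤ) = 4 * c + (d % 4 : ℕ) := ⟨d / 4, by omega⟩
        have hlt : d % 4 < 4 := Nat.mod_lt _ (by norm_num)
        generalize hr : d % 4 = r at *
        have hr' : r = 2 ∨ r = 3 := by omega
        rw [hc] at hN
        rcases hx with rfl | rfl <;> rcases hy with rfl | rfl <;> rcases hr' with rfl | rfl <;>
          first
          | exact ⟨x, y, rfl, rfl⟩
          | (exfalso; ring_nf at hN; omega)
      refine ⟨x, y, ?_⟩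
      push_cast at h
      linear_combination (1 / 2 : Fd d) * h

/-- For large discriminant, `𝒪_F` is generated over `ℤ` by a large `α` with small positive
conjugate. -/
lemma exists_large_generator {d : ℕ} (hd : Squarefree d)
    (hΔ : 29524500000005 ^ 2 < Delta d) :
    ∃ (α : Od d) (ι σ : Fd d →ₐ[ℚ] ℝ), 29524500000005 < ι α ∧
      0 < σ α ∧ σ α ≤ 1 ∧ (∀ τ : Fd d →ₐ[ℚ] ℝ, τ = ι ∨ τ = σ) ∧
      ∀ β : Fd d, IsIntegral ℤ β → ∃ x y : ℤ, β = x + y * α := by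
  have hsq : ¬ IsSquare d := by
    rintro ⟨k, rfl⟩
    have hk : k = 1 := Nat.isUnit_iff.1 (hd k dvd_rfl)
    subst hk
    norm_num [Delta] at hΔ
  obtain ⟨σ, hσ⟩ := exists_conj hsq
  obtain ⟨θ, hθ, hdiff, hgen⟩ := exists_integral_generator hd hσ
  set m : ℤ := ⌊-σ θ⌋ + 1 with hm
  have hint : IsIntegral ℤ (θ + (m : Fd d)) := hθ.add (isIntegral_algebraMap (x := m))
  have hσα : σ (θ + (m : Fd d)) = σ θ + m := by rw [map_add, map_intCast]
  have hfl := Int.floor_le (-σ θ)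
  have hlt := Int.lt_floor_add_one (-σ θ)
  have hmR : (m : ℝ) = ⌊-σ θ⌋ + 1 := by rw [hm]; push_cast; rfl
  have hsqrt : (29524500000005 : ℝ) < √(Delta d : ℝ) := by
    apply Real.lt_sqrt_of_sq_lt
    exact_mod_cast hΔ
  refine ⟨⟨θ + (m : Fd d), hint⟩, (Fd d).val, σ, ?_, ?_, ?_, algHom_eq_or_eq hσ, fun β hβ => ?_⟩
  · change (29524500000005 : ℝ) < ((θ + (m : Fd d) : Fd d) : ℝ)
    push_cast
    linarith
  · change 0 < σ (θ + (m : Fd d))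
    linarith
  · change σ (θ + (m : Fd d)) ≤ 1
    linarith
  · obtain ⟨x, y, h⟩ := hgen β hβ
    refine ⟨x - y * m, y, ?_⟩
    change β = _ + _ * (θ + (m : Fd d))
    push_cast
    linear_combination h

end QuadraticField

namespace QuadLattice

variable {d : ℕ} (L : QuadLattice d)

lemma B_zero_left (y : L.carrier) : L.B 0 y = 0 := by
  simpa using L.B_smul_left 0 0 y

lemma B_sum_left {ι : Type*} (s : Finset ι) (f : ι → L.carrier) (y : L.carrier) :
    L.B (∑ i ∈ s, f i) y = ∑ i ∈ s, L.B (f i) y := by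
  classical
  induction s using Finset.induction_on with
  | empty => simp [B_zero_left]
  | insert i s hi ih => rw [Finset.sum_insert hi, Finset.sum_insert hi, L.B_add_left, ih]

lemma B_add_right (x y z : L.carrier) : L.B x (y + z) = L.B x y + L.B x z := by
  rw [L.B_symm, L.B_add_left, L.B_symm y, L.B_symm z]

lemma B_smul_right (a : Od d) (x y : L.carrier) : L.B x (a • y) = (a : Fd d) * L.B x y := by
  rw [L.B_symm, L.B_smul_left, L.B_symm]

lemma Q_smul_add_smul_add_smul (a b c : Od d) (x y z : L.carrier) :
    (L.Q (a • x + b • y + c • z) : Fd d) =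
      a * a * L.Q x + b * b * L.Q y + c * c * L.Q z +
        2 * (a * b * L.B x y) + 2 * (a * c * L.B x z) + 2 * (b * c * L.B y z) := by
  rw [← L.B_self, ← L.B_self, ← L.B_self, ← L.B_self]
  simp only [L.B_add_left, L.B_add_right, L.B_smul_left, L.B_smul_right, L.B_symm y x,
    L.B_symm z x, L.B_symm z y]
  ring

variable {L}

lemma PosDef.map_Q_nonneg (hpd : L.PosDef) (τ : Fd d →ₐ[ℚ] ℝ) (x : L.carrier) :
    0 ≤ τ (L.Q x) := by
  by_cases hx : x = 0
  · rw [← L.B_self, hx, L.B_zero_left, map_zero]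
  · exact (hpd x hx τ).le

/-- The Cauchy–Schwarz inequality. -/
lemma PosDef.map_B_sq_le (hpd : L.PosDef) (hcl : L.IsClassic) (τ : Fd d →ₐ[ℚ] ℝ)
    (x y : L.carrier) : τ (L.B x y) ^ 2 ≤ τ (L.Q x) * τ (L.Q y) := by
  by_cases hx : x = 0
  · rw [← L.B_self, hx, L.B_zero_left, L.B_zero_left]
    simp
  · have hQ := hpd x hx τ
    set b : Od d := ⟨L.B x y, hcl x y⟩ with hb
    have hb' : (b : Fd d) = L.B x y := rfl
    have h := hpd.map_Q_nonneg τ ((-b) • x + L.Q x • y + (0 : Od d) • x)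
    rw [L.Q_smul_add_smul_add_smul] at h
    simp only [map_add, map_mul, map_neg, map_zero, map_ofNat, hb'] at h
    have h' : 0 ≤ τ (L.Q x) * (τ (L.Q x) * τ (L.Q y) - τ (L.B x y) ^ 2) := by
      linarith
    have := nonneg_of_mul_nonneg_right h' hQ
    linarith

end QuadLattice

section Bounds

variable {p q : ℤ} {t ε : ℝ}

lemma coeff_of_bounded (ht : 29524500000005 < t) (hε1 : ε ≤ 1)
    (h₁ : (p + q * t) ^ 2 ≤ 225 * t) (h₂ : (p + q * ε) ^ 2 ≤ 225) : q = 0 ∧ |p| ≤ 15 := by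
  have e₂ := abs_le_of_sq_le_sq' (by linarith : (p + q * ε) ^ 2 ≤ 15 ^ 2) (by norm_num)
  have e₁ := abs_le_of_sq_le_sq' (b := t / 1000) (a := p + q * t) (by nlinarith) (by linarith)
  have hq : q = 0 := by
    by_contra hq
    rcases lt_or_gt_of_ne hq with h | h
    · have : (q : ℝ) ≤ -1 := by exact_mod_cast (by omega : q ≤ -1)
      nlinarith
    · have : (1 : ℝ) ≤ q := by exact_mod_cast (by omega : 1 ≤ q)
      nlinarith
  subst hq
  refine ⟨rfl, ?_⟩
  simp only [Int.cast_zero, zero_mul, add_zero] at e₂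
  rw [abs_le]
  exact ⟨by exact_mod_cast e₂.1, by exact_mod_cast e₂.2⟩

lemma coeff_of_bounded_mul (ht : 29524500000005 < t) (hε : 0 < ε) (hε1 : ε ≤ 1)
    (h₁ : (p + q * t) ^ 2 ≤ (15 * t) ^ 2) (h₂ : (p + q * ε) ^ 2 ≤ 225) :
    |q| ≤ 15 ∧ |p| ≤ 30 := by
  have e₂ := abs_le_of_sq_le_sq' (by linarith : (p + q * ε) ^ 2 ≤ 15 ^ 2) (by norm_num)
  have e₁ := abs_le_of_sq_le_sq' h₁ (by linarith)
  have hq : |q| ≤ 15 := by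
    by_contra! hq
    rcases lt_abs.1 hq with h | h
    · have : (16 : ℝ) ≤ q := by exact_mod_cast (by omega : 16 ≤ q)
      nlinarith
    · have : (q : ℝ) ≤ -16 := by exact_mod_cast (by omega : q ≤ -16)
      nlinarith
  refine ⟨hq, ?_⟩
  rw [abs_le] at hq
  have hl : (-15 : ℝ) ≤ q := by exact_mod_cast hq.1
  have hu : (q : ℝ) ≤ 15 := by exact_mod_cast hq.2
  have e₃ : (q : ℝ) * ε ≤ 15 := by nlinarith
  have e₄ : -15 ≤ (q : ℝ) * ε := by nlinarith
  have f₁ : (-30 : ℝ) ≤ p := by linarith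
  have f₂ : (p : ℝ) ≤ 30 := by linarith
  rw [abs_le]
  exact ⟨by exact_mod_cast f₁, by exact_mod_cast f₂⟩

lemma mul_mul_le_of_abs_le {x y g : ℤ} (hx : |x| ≤ 15) (hy : |y| ≤ 15) (hg : |g| ≤ 30) :
    x * y * g ≤ 6750 := by
  calc x * y * g ≤ |x * y * g| := le_abs_self _
    _ = |x| * |y| * |g| := by rw [abs_mul, abs_mul]
    _ ≤ 15 * 15 * 30 := by gcongr
    _ = 6750 := by norm_num

end Bounds

/-- **Theorem (Statement 1).** If `d` is a squarefree positive integer with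
discriminant `Δ_d > 29524500000005²`, then every positive definite classic
universal quadratic `𝒪_F`-lattice over `F = ℚ(√d)` has rank at least 8; more
precisely, it contains 8 linearly independent vectors. -/
theorem classic_universal_lattice_rank_ge_eight
    (d : ℕ) (hd : Squarefree d) (hdpos : 0 < d)
    (hΔ : 29524500000005 ^ 2 < Delta d)
    (L : QuadLattice d) (hcl : L.IsClassic) (hpd : L.PosDef) (hun : L.Universal) :
    8 ≤ Module.rank (Od d) L.carrier ∧
      ∃ v : Fin 8 → L.carrier, LinearIndependent (Od d) v := by
  suffices h : ∃ v : Fin 8 → L.carrier, LinearIndependent (Od d) v by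
    refine ⟨?_, h⟩
    obtain ⟨v, hv⟩ := h
    simpa using hv.cardinal_le_rank
  obtain ⟨α, ι, σ, ht, hε, hε1, hτ, hbasis⟩ := exists_large_generator hd hΔ
  set t := ι α
  set ε := σ α
  -- coordinates of the values of `B` with respect to the basis `1, α`
  choose X Y hXY using fun x y => hbasis (L.B x y) (hcl x y)
  have hιB : ∀ x y, ι (L.B x y) = X x y + Y x y * t := fun x y => by
    rw [hXY x y, map_add, map_mul, map_intCast, map_intCast]
  have hσB : ∀ x y, σ (L.B x y) = X x y + Y x y * ε := fun x y => by
    rw [hXY x y, map_add, map_mul, map_intCast, map_intCast]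
  have huniq : ∀ {x y : L.carrier} {p q : ℤ}, L.B x y = p + q * α → X x y = p ∧ Y x y = q := by
    intro x y p q h
    have h₁ := hιB x y
    have h₂ := hσB x y
    rw [h, map_add, map_mul, map_intCast, map_intCast] at h₁ h₂
    have h₃ : ((q : ℝ) - Y x y) * (t - ε) = 0 := by linear_combination h₁ - h₂
    have h₄ : t - ε ≠ 0 := by linarith
    have h₅ : (q : ℝ) = Y x y := sub_eq_zero.1 ((mul_eq_zero.1 h₃).resolve_right h₄)
    rw [h₅] at h₁
    have h₆ : (p : ℝ) = X x y := add_right_cancel h₁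
    exact ⟨(by exact_mod_cast h₆.symm), by exact_mod_cast h₅.symm⟩
  have hsymm : ∀ x y, X x y = X y x ∧ Y x y = Y y x := fun x y =>
    huniq ((L.B_symm x y).trans (hXY y x))
  have hrep : ∀ a : Od d, (a = 0 ∨ ∀ τ : Fd d →ₐ[ℚ] ℝ, 0 < τ a) → ∃ v, L.Q v = a := by
    intro a ha
    have : a ∈ Set.range fun v => L.Q v := by
      rw [hun]
      rcases ha with ha | ha
      · exact Or.inr ha
      · exact Or.inl ha
    exact this
  have hu' : ∀ n : ℕ, ∃ v, L.Q v = (n : Od d) := fun n => by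
    refine hrep _ (n.eq_zero_or_pos.imp (fun h => by simp [h]) fun h τ => ?_)
    simpa using h
  have hw' : ∀ n : ℕ, ∃ v, L.Q v = (n : Od d) * α := fun n => by
    refine hrep _ (n.eq_zero_or_pos.imp (fun h => by simp [h]) fun h τ => ?_)
    have hn : (0 : ℝ) < n := by exact_mod_cast h
    have e : τ ((n : Od d) * α : Od d) = n * τ α := by simp
    rw [e]
    refine mul_pos hn ?_
    rcases hτ τ with rfl | rfl
    · exact (by linarith : 0 < t)
    · exact hε
  choose u hu using hu'
  choose w hw using hw'
  have huB : ∀ n, X (u n) (u n) = n ∧ Y (u n) (u n) = 0 := fun n =>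
    huniq (by rw [L.B_self, hu]; simp)
  have hwB : ∀ n, X (w n) (w n) = 0 ∧ Y (w n) (w n) = n := fun n =>
    huniq (by rw [L.B_self, hw]; simp)
  have huτ : ∀ (τ : Fd d →ₐ[ℚ] ℝ) n, τ (L.Q (u n)) = n := fun τ n => by rw [hu]; simp
  have hwτ : ∀ (τ : Fd d →ₐ[ℚ] ℝ) n, τ (L.Q (w n)) = n * τ α := fun τ n => by rw [hw]; simp
  have h225 : ∀ {i j : ℕ}, i ≤ 15 → j ≤ 15 → (0 : ℝ) ≤ i * j ∧ (i * j : ℝ) ≤ 225 := by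
    intro i j hi hj
    refine ⟨by positivity, ?_⟩
    exact_mod_cast (Nat.mul_le_mul hi hj : i * j ≤ 15 * 15)
  have huu : ∀ i ≤ 15, ∀ j ≤ 15, Y (u i) (u j) = 0 ∧ |X (u i) (u j)| ≤ 15 := by
    intro i hi j hj
    have h₁ := hpd.map_B_sq_le hcl ι (u i) (u j)
    have h₂ := hpd.map_B_sq_le hcl σ (u i) (u j)
    rw [huτ, huτ, hιB] at h₁
    rw [huτ, huτ, hσB] at h₂
    have h := h225 hi hj
    exact coeff_of_bounded ht hε1 (by linarith) (by linarith)
  have huw : ∀ i ≤ 15, ∀ j ≤ 15, Y (u i) (w j) = 0 ∧ |X (u i) (w j)| ≤ 15 := by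
    intro i hi j hj
    have h₁ := hpd.map_B_sq_le hcl ι (u i) (w j)
    have h₂ := hpd.map_B_sq_le hcl σ (u i) (w j)
    rw [huτ, hwτ, hιB] at h₁
    rw [huτ, hwτ, hσB] at h₂
    have h := h225 hi hj
    exact coeff_of_bounded ht hε1 (by nlinarith) (by nlinarith)
  have hww : ∀ i ≤ 15, ∀ j ≤ 15, |Y (w i) (w j)| ≤ 15 ∧ |X (w i) (w j)| ≤ 30 := by
    intro i hi j hj
    have h₁ := hpd.map_B_sq_le hcl ι (w i) (w j)
    have h₂ := hpd.map_B_sq_le hcl σ (w i) (w j)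
    rw [hwτ, hwτ, hιB] at h₁
    rw [hwτ, hwτ, hσB] at h₂
    have h := h225 hi hj
    refine coeff_of_bounded_mul ht hε hε1 (h₁.trans ?_) (h₂.trans ?_)
    · calc (i * t) * (j * t) = (i * j) * t ^ 2 := by ring
        _ ≤ 225 * t ^ 2 := by gcongr; exact h.2
        _ = (15 * t) ^ 2 := by ring
    · calc (i * ε) * (j * ε) = (i * j) * ε ^ 2 := by ring
        _ ≤ 225 * 1 ^ 2 := by gcongr; exact h.2
        _ = 225 := by ring
  have hform : ∀ (a b c : L.carrier) (x y z : ℤ),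
      (0 : ℝ) ≤ ((x * x * X a a + y * y * X b b + z * z * X c c + 2 * (x * y * X a b) +
          2 * (x * z * X a c) + 2 * (y * z * X b c) : ℤ) : ℝ) +
        ((x * x * Y a a + y * y * Y b b + z * z * Y c c + 2 * (x * y * Y a b) +
          2 * (x * z * Y a c) + 2 * (y * z * Y b c) : ℤ) : ℝ) * t := by
    intro a b c x y z
    have h := hpd.map_Q_nonneg ι ((x : Od d) • a + (y : Od d) • b + (z : Od d) • c)
    rw [L.Q_smul_add_smul_add_smul, ← L.B_self, ← L.B_self, ← L.B_self] at h
    simp only [map_add, map_mul, map_intCast, map_ofNat, hιB] at h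
    push_cast
    linarith
  obtain ⟨s, hs, hsdet⟩ := exists_gram_det_ne_zero (fun i j => X (u i) (u j))
    (fun i j => (hsymm _ _).1) (fun i _ => (huB i).1) (fun i hi j hj => (huu i hi j hj).2) (by
      intro i hi j hj k hk x y z _ _ _
      have h := hform (u i) (u j) (u k) x y z
      rw [(huB i).2, (huB j).2, (huB k).2, (huu i hi j hj).1, (huu i hi k hk).1,
        (huu j hj k hk).1] at h
      simp only [mul_zero, add_zero, Int.cast_zero, zero_mul] at h
      exact_mod_cast h)
  obtain ⟨r, hr, hrdet⟩ := exists_gram_det_ne_zero (fun i j => Y (w i) (w j))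
    (fun i j => (hsymm _ _).2) (fun i _ => (hwB i).2) (fun i hi j hj => (hww i hi j hj).1) (by
      intro i hi j hj k hk x y z hx hy hz
      have h := hform (w i) (w j) (w k) x y z
      rw [(hwB i).1, (hwB j).1, (hwB k).1] at h
      have e₁ := mul_mul_le_of_abs_le hx hy (hww i hi j hj).2
      have e₂ := mul_mul_le_of_abs_le hx hz (hww i hi k hk).2
      have e₃ := mul_mul_le_of_abs_le hy hz (hww j hj k hk).2
      by_contra! hneg
      generalize x * x * Y (w i) (w i) + y * y * Y (w j) (w j) + z * z * Y (w k) (w k) +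
        2 * (x * y * Y (w i) (w j)) + 2 * (x * z * Y (w i) (w k)) +
        2 * (y * z * Y (w j) (w k)) = P at h hneg
      have hP : (P : ℝ) ≤ -1 := by exact_mod_cast (by omega : P ≤ -1)
      have hR : ((x * x * 0 + y * y * 0 + z * z * 0 + 2 * (x * y * X (w i) (w j)) +
          2 * (x * z * X (w i) (w k)) + 2 * (y * z * X (w j) (w k)) : ℤ) : ℝ) ≤ 40500 := by
        exact_mod_cast (by linarith)
      nlinarith)
  have hli : LinearIndependent (Od d) (Sum.elim (fun i => u (s i)) (fun i => w (r i))) := by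
    rw [Fintype.linearIndependent_iff]
    intro c hc
    have hrel : ∀ v, ∑ i, ι (c (Sum.inl i)) * ι (L.B (u (s i)) v) +
        ∑ i, ι (c (Sum.inr i)) * ι (L.B (w (r i)) v) = 0 := by
      intro v
      have h := congrArg (fun z => ι (L.B z v)) hc
      simpa only [Fintype.sum_sum_type, Sum.elim_inl, Sum.elim_inr, L.B_add_left, L.B_sum_left,
        L.B_smul_left, L.B_zero_left, map_add, map_sum, map_mul, map_zero] using h
    obtain ⟨h₁, h₂⟩ := block_system_trivial (Matrix.of fun i j => X (u (s i)) (u (s j)))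
      (Matrix.of fun i j => X (u (s i)) (w (r j))) (Matrix.of fun i j => X (w (r i)) (w (r j)))
      (Matrix.of fun i j => Y (w (r i)) (w (r j)))
      (fun i j => (huu _ (hs i) _ (hs j)).2) (fun i j => (huw _ (hs i) _ (hr j)).2)
      (fun i j => (hww _ (hr i) _ (hr j)).2) (fun i j => (hww _ (hr i) _ (hr j)).1)
      hsdet hrdet ht (fun i => ι (c (Sum.inl i))) (fun i => ι (c (Sum.inr i)))
      (fun i => by
        rw [← hrel (u (s i))]
        congr 1 <;> refine Finset.sum_congr rfl fun j _ => ?_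
        · rw [L.B_symm, hιB, (huu _ (hs i) _ (hs j)).1, Matrix.of_apply]
          push_cast
          ring
        · rw [L.B_symm, hιB, (huw _ (hs i) _ (hr j)).1, Matrix.of_apply]
          push_cast
          ring)
      (fun i => by
        rw [← hrel (w (r i))]
        congr 1 <;> refine Finset.sum_congr rfl fun j _ => ?_
        · rw [hιB, (huw _ (hs j) _ (hr i)).1, Matrix.of_apply]
          push_cast
          ring
        · rw [L.B_symm, hιB, Matrix.of_apply, Matrix.of_apply]
          ring)
    have hinj : ∀ a : Od d, ι a = 0 → a = 0 := fun a ha =>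
      NumberField.RingOfIntegers.coe_injective (ι.injective (by simpa using ha))
    rintro (i | i)
    · exact hinj _ (congrFun h₁ i)
    · exact hinj _ (congrFun h₂ i)
  exact ⟨_, hli.comp (finSumFinEquiv (m := 4) (n := 4)).symm (Equiv.injective _)⟩
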